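/- For every n ≥ 1, the statistics ℓ, nmaj, and fmaj are equidistributed over B_n: Σ_{π ∈ B_n} q^{ℓ(π)} = Σ_{π ∈ B_n} q^{nmaj(π)} = Σ_{π ∈ B_n} q^{fmaj(π)}. -/

import Mathlib

open Finset

/-- `π` is an element of the hyperoctahedral group `B_n`: a bijection of `ℤ`
satisfying `π (-a) = -π a` for all `a`, and fixing every `a` with `|a| > n`
(so it restricts to a bijection of `{-n,…,-1,1,…,n}`). -/
def IsSignedPerm (n : ℕ) (π : Equiv.Perm ℤ) : Prop :=
  (∀ a : ℤ, π (-a) = - π a) ∧ ∀ a : ℤ, (n : ℤ) < |a| → π a = a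

/-- The hyperoctahedral group `B_n`, as a set of permutations of `ℤ`. -/
def BSet (n : ℕ) : Set (Equiv.Perm ℤ) := {π | IsSignedPerm n π}

/-- The descent set `Des_A(π) = {i ∈ [n-1] : π(i) > π(i+1)}`. -/
def DesA (n : ℕ) (π : Equiv.Perm ℤ) : Finset ℕ :=
  (Finset.Icc 1 (n - 1)).filter fun i => π ((i : ℤ) + 1) < π (i : ℤ)

/-- `des_A(π)`, the number of descents of the window `π(1),…,π(n)`. -/
def desA (n : ℕ) (π : Equiv.Perm ℤ) : ℕ := (DesA n π).card

/-- `maj_A(π) = Σ_{i : π(i) > π(i+1)} i`. -/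
def majA (n : ℕ) (π : Equiv.Perm ℤ) : ℕ := ∑ i ∈ DesA n π, i

/-- `Neg(π) = {i ∈ [n] : π(i) < 0}`. -/
def NegSet (n : ℕ) (π : Equiv.Perm ℤ) : Finset ℕ :=
  (Finset.Icc 1 n).filter fun i => π (i : ℤ) < 0

/-- `neg(π) = |Neg(π)|`. -/
def negStat (n : ℕ) (π : Equiv.Perm ℤ) : ℕ := (NegSet n π).card

/-- `-Σ_{i ∈ Neg(π)} π(i) = Σ_{i ∈ Neg(π)} |π(i)|`, as a natural number. -/
def negSum (n : ℕ) (π : Equiv.Perm ℤ) : ℕ := ∑ i ∈ NegSet n π, (π (i : ℤ)).natAbs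

/-- `inv(π) = #{(i,j) : 1 ≤ i < j ≤ n, π(i) > π(j)}`. -/
def invStat (n : ℕ) (π : Equiv.Perm ℤ) : ℕ :=
  (((Finset.Icc 1 n) ×ˢ (Finset.Icc 1 n)).filter
    (fun p => p.1 < p.2 ∧ π ((p.2 : ℕ) : ℤ) < π ((p.1 : ℕ) : ℤ))).card

/-- The Coxeter length `ℓ(π) = inv(π) - Σ_{i ∈ Neg(π)} π(i)`. -/
def lenB (n : ℕ) (π : Equiv.Perm ℤ) : ℕ := invStat n π + negSum n π

/-- The negative major index `nmaj(π) = maj_A(π) - Σ_{i ∈ Neg(π)} π(i)`. -/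
def nmaj (n : ℕ) (π : Equiv.Perm ℤ) : ℕ := majA n π + negSum n π

/-- The negative descent number `ndes(π) = des_A(π) + neg(π)`. -/
def ndes (n : ℕ) (π : Equiv.Perm ℤ) : ℕ := desA n π + negStat n π

/-- The flag major index `fmaj(π) = 2 maj_A(π) + neg(π)`. -/
def fmaj (n : ℕ) (π : Equiv.Perm ℤ) : ℕ := 2 * majA n π + negStat n π

/-- The flag descent number `fd(π) = 2 des_A(π) + ε₁(π)`. -/
def fd (n : ℕ) (π : Equiv.Perm ℤ) : ℕ :=
  2 * desA n π + (if π 1 < 0 then 1 else 0)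

/-- The symmetric group `S_n`, embedded in `B_n` as the signed permutations
with all window entries positive. -/
def SnSet (n : ℕ) : Set (Equiv.Perm ℤ) :=
  {π | IsSignedPerm n π ∧ ∀ i ∈ Finset.Icc 1 n, 0 < π (i : ℤ)}

/-- `T = {π ∈ B_n : des_A(π) = 0}`. -/
def TSet (n : ℕ) : Set (Equiv.Perm ℤ) :=
  {π | IsSignedPerm n π ∧ desA n π = 0}

namespace SignedWord

/-- The number of elements of `S` exceeding `a`. -/
def numGt (S : Finset ℤ) (a : ℤ) : ℕ := (S.filter (a < ·)).card

/-- The arrangements of an `n`-element set `S` as lists without repetition. -/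
def words : ℕ → Finset ℤ → Finset (List ℤ)
  | 0, _ => {[]}
  | n + 1, S => S.biUnion fun a => (words n (S.erase a)).image (List.cons a)

/-- The number of inversions of a word, read from right to left. -/
def listInv : List ℤ → ℕ
  | [] => 0
  | a :: l => listInv l + l.countP (a < ·)

/-- The major index of a word, read from right to left. -/
def listMaj : List ℤ → ℕ
  | [] => 0
  | [_] => 0
  | a :: b :: l => listMaj (b :: l) + if a < b then l.length + 1 else 0

/-- The list `[w n, …, w 1]`. -/
def word (w : ℕ → ℤ) : ℕ → List ℤ
  | 0 => []
  | n + 1 => w (n + 1) :: word w n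

/-- The `q`-factorial. -/
def qFactorial {R : Type*} [CommRing R] (q : R) (n : ℕ) : R :=
  ∏ i ∈ range n, ∑ k ∈ range (i + 1), q ^ k

/-- The set `{1, …, n}` with the elements of `J` negated. -/
def signedSet (n : ℕ) (J : Finset ℕ) : Finset ℤ :=
  (Icc 1 n).image fun j : ℕ => if j ∈ J then -(j : ℤ) else j

theorem sum_words_succ {R : Type*} [CommRing R] (n : ℕ) (S : Finset ℤ) (F : List ℤ → R) :
    ∑ l ∈ words (n + 1) S, F l = ∑ a ∈ S, ∑ l ∈ words n (S.erase a), F (a :: l) := by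
  rw [words, sum_biUnion]
  · refine sum_congr rfl fun a _ => ?_
    rw [sum_image]
    intro x _ y _ h
    simpa using h
  · intro a _ b _ hab
    rw [Function.onFun, disjoint_left]
    intro l hl hl'
    simp only [mem_image] at hl hl'
    obtain ⟨x, -, rfl⟩ := hl
    obtain ⟨y, -, h⟩ := hl'
    simp only [List.cons.injEq] at h
    exact hab h.1.symm

theorem spec_of_mem_words {n : ℕ} : ∀ {S : Finset ℤ} {l : List ℤ}, S.card = n → l ∈ words n S →
    l.length = n ∧ l.Nodup ∧ l.toFinset = S := by
  induction n with
  | zero =>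
    intro S l hS hl
    simp only [words, mem_singleton] at hl
    subst hl
    simp [card_eq_zero.mp hS]
  | succ n ih =>
    intro S l hS hl
    simp only [words, mem_biUnion, mem_image] at hl
    obtain ⟨a, ha, l, hl, rfl⟩ := hl
    obtain ⟨h1, h2, h3⟩ := ih (by rw [card_erase_of_mem ha, hS]; rfl) hl
    refine ⟨by simp [h1], ?_, ?_⟩
    · rw [List.nodup_cons, ← List.mem_toFinset, h3]
      simp [h2]
    · rw [List.toFinset_cons, h3, insert_erase ha]

theorem sum_numGt {R : Type*} [CommRing R] (f : ℕ → R) (T : Finset ℤ) :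
    ∑ b ∈ T, f (numGt T b) = ∑ k ∈ range T.card, f k := by
  induction T using Finset.induction_on_min with
  | empty => simp
  | insert a s h ih =>
    have ha : a ∉ s := fun h' => lt_irrefl _ (h a h')
    rw [sum_insert ha, card_insert_of_notMem ha, sum_range_succ, ← ih, add_comm]
    congr 1
    · refine sum_congr rfl fun b hb => ?_
      rw [numGt, numGt, filter_insert, if_neg (h b hb).not_gt]
    · rw [numGt, filter_insert, if_neg (lt_irrefl a), filter_true_of_mem h]

theorem sum_words_listInv {R : Type*} [CommRing R] (q : R) (n : ℕ) :
    ∀ S : Finset ℤ, S.card = n → ∑ l ∈ words n S, q ^ listInv l = qFactorial q n := by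
  induction n with
  | zero => intro S _; simp [words, listInv, qFactorial]
  | succ n ih =>
    intro S hS
    rw [sum_words_succ]
    have key : ∀ a ∈ S, ∑ l ∈ words n (S.erase a), q ^ listInv (a :: l) =
        qFactorial q n * q ^ numGt S a := by
      intro a ha
      have hc : (S.erase a).card = n := by rw [card_erase_of_mem ha, hS]; rfl
      rw [← ih _ hc, sum_mul]
      refine sum_congr rfl fun l hl => ?_
      obtain ⟨-, h2, h3⟩ := spec_of_mem_words hc hl
      rw [listInv, pow_add]
      congr 2
      rw [List.countP_eq_length_filter, ← List.toFinset_card_of_nodup (h2.filter _),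
        List.toFinset_filter, h3, numGt]
      congr 1
      ext x
      simp only [mem_filter, mem_erase, decide_eq_true_eq]
      constructor
      · rintro ⟨⟨-, h⟩, h'⟩; exact ⟨h, h'⟩
      · rintro ⟨h, h'⟩; exact ⟨⟨h'.ne', h⟩, h'⟩
    rw [sum_congr rfl key, ← mul_sum, sum_numGt (fun k => q ^ k), hS, qFactorial, qFactorial,
      prod_range_succ]

theorem sum_erase_numGt {R : Type*} [CommRing R] (q : R) (n : ℕ) (S : Finset ℤ)
    (hS : S.card = n + 1) (a : ℤ) (ha : a ∈ S) :
    ∑ b ∈ S.erase a, q ^ (numGt (S.erase a) b + if a < b then n else 0) =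
      q ^ numGt S a * ∑ k ∈ range n, q ^ k := by
  have hc : (S.erase a).card = n := by rw [card_erase_of_mem ha, hS]; rfl
  set T := S.erase a with hT
  have hm : numGt S a = (T.filter (a < ·)).card := by
    rw [numGt, hT]
    congr 1
    ext x
    simp only [mem_filter, mem_erase]
    constructor
    · rintro ⟨h, h'⟩; exact ⟨⟨h'.ne', h⟩, h'⟩
    · rintro ⟨⟨-, h⟩, h'⟩; exact ⟨h, h'⟩
  have hcard := card_filter_add_card_filter_not (s := T) (fun x => a < x)
  rw [← sum_filter_add_sum_filter_not T (fun x => a < x)]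
  have h1 : ∑ b ∈ T.filter (fun x => a < x), q ^ (numGt T b + if a < b then n else 0) =
      ∑ k ∈ range (numGt S a), q ^ (k + n) := by
    rw [hm, ← sum_numGt (fun k => q ^ (k + n))]
    refine sum_congr rfl fun b hb => ?_
    have hab := (mem_filter.mp hb).2
    rw [if_pos hab, numGt, numGt, filter_filter]
    congr 3
    ext x
    simp only [mem_filter, and_congr_right_iff]
    intro _
    exact ⟨fun h => ⟨hab.trans h, h⟩, fun h => h.2⟩
  have h2 : ∑ b ∈ T.filter (fun x => ¬ a < x), q ^ (numGt T b + if a < b then n else 0) =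
      ∑ k ∈ range (n - numGt S a), q ^ (numGt S a + k) := by
    have hc' : n - numGt S a = (T.filter (fun x => ¬ a < x)).card := by omega
    rw [hc', ← sum_numGt (fun k => q ^ (numGt S a + k))]
    refine sum_congr rfl fun b hb => ?_
    obtain ⟨hbT, hab⟩ := mem_filter.mp hb
    have hba : b < a := lt_of_le_of_ne (not_lt.mp hab) (ne_of_mem_erase hbT)
    rw [if_neg hab, add_zero, hm, numGt, numGt,
      ← card_filter_add_card_filter_not (s := T.filter (b < ·)) (fun x => a < x),
      filter_filter, filter_filter, filter_filter]
    refine congrArg (q ^ ·) (congrArg₂ (· + ·) (congrArg card ?_) (congrArg card ?_))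
    · ext x
      simp only [mem_filter, and_congr_right_iff]
      intro _
      exact ⟨fun h => h.2, fun h => ⟨hba.trans h, h⟩⟩
    · ext x
      simp only [mem_filter, and_congr_right_iff]
      intro _
      exact and_comm
  have hle : numGt S a ≤ n := by omega
  rw [h1, h2, add_comm, mul_sum]
  obtain ⟨d, rfl⟩ := Nat.exists_eq_add_of_le' hle
  rw [Nat.add_sub_cancel, sum_range_add]
  congr 1
  · exact sum_congr rfl fun k _ => pow_add _ _ _
  · refine sum_congr rfl fun k _ => ?_
    rw [← pow_add]
    congr 1
    omega

theorem sum_words_listMaj_cons {R : Type*} [CommRing R] (q : R) (n : ℕ) :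
    ∀ S : Finset ℤ, S.card = n + 1 → ∀ a ∈ S,
      ∑ l ∈ words n (S.erase a), q ^ listMaj (a :: l) = q ^ numGt S a * qFactorial q n := by
  induction n with
  | zero =>
    intro S hS a ha
    obtain ⟨b, rfl⟩ := card_eq_one.mp hS
    obtain rfl := mem_singleton.mp ha
    simp [words, listMaj, qFactorial, numGt, filter_singleton]
  | succ n ih =>
    intro S hS a ha
    have hc : (S.erase a).card = n + 1 := by rw [card_erase_of_mem ha, hS]; rfl
    rw [sum_words_succ]
    have key : ∀ b ∈ S.erase a, ∑ l ∈ words n ((S.erase a).erase b), q ^ listMaj (a :: b :: l) =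
        q ^ (numGt (S.erase a) b + if a < b then n + 1 else 0) * qFactorial q n := by
      intro b hb
      have hcb : ((S.erase a).erase b).card = n := by rw [card_erase_of_mem hb, hc]; rfl
      rw [pow_add, mul_right_comm, ← ih _ hc b hb, sum_mul]
      refine sum_congr rfl fun l hl => ?_
      rw [listMaj, pow_add, (spec_of_mem_words hcb hl).1]
    rw [sum_congr rfl key, ← sum_mul, sum_erase_numGt q (n + 1) S hS a ha, qFactorial, qFactorial,
      prod_range_succ, mul_assoc, mul_comm (∑ k ∈ range (n + 1), q ^ k)]

theorem sum_words_listMaj {R : Type*} [CommRing R] (q : R) (n : ℕ) (S : Finset ℤ)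
    (hS : S.card = n) : ∑ l ∈ words n S, q ^ listMaj l = qFactorial q n := by
  cases n with
  | zero => simp [words, listMaj, qFactorial]
  | succ n =>
    rw [sum_words_succ, sum_congr rfl (sum_words_listMaj_cons q n S hS), ← sum_mul,
      sum_numGt (fun k => q ^ k), hS, qFactorial, qFactorial, prod_range_succ, mul_comm]

theorem mem_word {w : ℕ → ℤ} {n : ℕ} {x : ℤ} : x ∈ word w n ↔ ∃ i ∈ Icc 1 n, w i = x := by
  induction n with
  | zero => simp [word]
  | succ n ih =>
    rw [word, List.mem_cons, ih, ← insert_Icc_right_eq_Icc_add_one (by omega), exists_mem_insert,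
      eq_comm]

theorem toFinset_word (w : ℕ → ℤ) (n : ℕ) : (word w n).toFinset = (Icc 1 n).image w := by
  ext x
  rw [List.mem_toFinset, mem_word, mem_image]

theorem length_word (w : ℕ → ℤ) (n : ℕ) : (word w n).length = n := by
  induction n with
  | zero => rfl
  | succ n ih => rw [word, List.length_cons, ih]

theorem word_eq_word_iff {w v : ℕ → ℤ} {n : ℕ} :
    word w n = word v n ↔ ∀ i ∈ Icc 1 n, w i = v i := by
  induction n with
  | zero => simp [word]
  | succ n ih =>
    rw [word, word, List.cons.injEq, ih, ← insert_Icc_right_eq_Icc_add_one (by omega),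
      forall_mem_insert]

theorem image_Icc_erase {w : ℕ → ℤ} {n : ℕ} (hw : Set.InjOn w (Icc 1 (n + 1) : Finset ℕ)) :
    ((Icc 1 (n + 1)).image w).erase (w (n + 1)) = (Icc 1 n).image w := by
  rw [← insert_Icc_right_eq_Icc_add_one (by omega), image_insert, erase_insert]
  intro h
  obtain ⟨i, hi, h⟩ := mem_image.mp h
  rw [mem_Icc] at hi
  have := hw (by simp; omega) (by simp) h
  omega

theorem word_mem_words {w : ℕ → ℤ} {n : ℕ} (hw : Set.InjOn w (Icc 1 n : Finset ℕ)) :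
    word w n ∈ words n ((Icc 1 n).image w) := by
  induction n with
  | zero => simp [word, words]
  | succ n ih =>
    rw [words, mem_biUnion]
    refine ⟨w (n + 1), mem_image_of_mem _ (by simp), ?_⟩
    rw [image_Icc_erase hw]
    exact mem_image_of_mem _ (ih (hw.mono (coe_subset.mpr (Icc_subset_Icc_right n.le_succ))))

theorem exists_word_of_length (l : List ℤ) : ∃ w : ℕ → ℤ, word w l.length = l := by
  induction l with
  | nil => exact ⟨fun _ => 0, rfl⟩
  | cons a l ih =>
    obtain ⟨w, hw⟩ := ih
    refine ⟨Function.update w (l.length + 1) a, ?_⟩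
    rw [List.length_cons, word, Function.update_self]
    congr 1
    conv_rhs => rw [← hw]
    rw [word_eq_word_iff]
    intro i hi
    rw [mem_Icc] at hi
    exact Function.update_of_ne (by omega) _ _

theorem exists_word_of_mem_words {n : ℕ} {S : Finset ℤ} {l : List ℤ} (hS : S.card = n)
    (hl : l ∈ words n S) :
    ∃ w : ℕ → ℤ, word w n = l ∧ (Icc 1 n).image w = S ∧ Set.InjOn w (Icc 1 n : Finset ℕ) := by
  obtain ⟨h1, -, h3⟩ := spec_of_mem_words hS hl
  obtain ⟨w, hw⟩ := exists_word_of_length l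
  rw [h1] at hw
  have him : (Icc 1 n).image w = S := by rw [← toFinset_word, hw, h3]
  refine ⟨w, hw, him, ?_⟩
  rw [← card_image_iff, him, hS, Nat.card_Icc, Nat.add_sub_cancel]

theorem mem_signedSet {n : ℕ} {J : Finset ℕ} {x : ℤ} :
    x ∈ signedSet n J ↔ x.natAbs ∈ Icc 1 n ∧ (x < 0 ↔ x.natAbs ∈ J) := by
  simp only [signedSet, mem_image]
  constructor
  · rintro ⟨j, hj, rfl⟩
    have := mem_Icc.mp hj
    split_ifs with h
    · simp [h, hj]; omega
    · simp [h, hj]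
  · rintro ⟨h1, h2⟩
    refine ⟨_, h1, ?_⟩
    split_ifs with h
    · have := h2.mpr h; omega
    · have := mt h2.mp h; omega

theorem natAbs_injOn_signedSet (n : ℕ) (J : Finset ℕ) :
    Set.InjOn Int.natAbs (signedSet n J : Set ℤ) := by
  intro x hx y hy h
  obtain ⟨-, hx⟩ := mem_signedSet.mp hx
  obtain ⟨-, hy⟩ := mem_signedSet.mp hy
  rw [h, ← hy] at hx
  omega

theorem image_natAbs_signedSet (n : ℕ) (J : Finset ℕ) :
    (signedSet n J).image Int.natAbs = Icc 1 n := by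
  ext j
  simp only [mem_image]
  constructor
  · rintro ⟨x, hx, rfl⟩
    exact (mem_signedSet.mp hx).1
  · intro hj
    refine ⟨_, mem_image_of_mem _ hj, ?_⟩
    split_ifs <;> simp

theorem card_signedSet (n : ℕ) (J : Finset ℕ) : (signedSet n J).card = n := by
  rw [← card_image_of_injOn (natAbs_injOn_signedSet n J), image_natAbs_signedSet, Nat.card_Icc,
    Nat.add_sub_cancel]

theorem image_natAbs_neg_signedSet {n : ℕ} {J : Finset ℕ} (hJ : J ⊆ Icc 1 n) :
    ((signedSet n J).filter (· < 0)).image Int.natAbs = J := by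
  ext j
  simp only [mem_image, mem_filter]
  constructor
  · rintro ⟨x, ⟨hx, h0⟩, rfl⟩
    exact (mem_signedSet.mp hx).2.mp h0
  · intro hj
    have := mem_Icc.mp (hJ hj)
    refine ⟨-(j : ℤ), ⟨mem_signedSet.mpr ?_, by omega⟩, by simp⟩
    simp only [Int.natAbs_neg, Int.natAbs_natCast]
    exact ⟨hJ hj, fun _ => hj, fun _ => by omega⟩

theorem sum_neg_signedSet {n : ℕ} {J : Finset ℕ} (hJ : J ⊆ Icc 1 n) (h : ℕ → ℕ) :
    ∑ x ∈ (signedSet n J).filter (· < 0), h x.natAbs = ∑ j ∈ J, h j := by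
  conv_rhs => rw [← image_natAbs_neg_signedSet hJ]
  rw [sum_image]
  exact (natAbs_injOn_signedSet n J).mono (coe_subset.mpr (filter_subset _ _))

/-- The window of a permutation of `ℤ`, as a function on `ℕ`. -/
def window (π : Equiv.Perm ℤ) (i : ℕ) : ℤ := π i

theorem window_injective (π : Equiv.Perm ℤ) : Function.Injective (window π) := by
  intro i j h
  exact_mod_cast π.injective h

theorem exists_image_window_eq_signedSet {n : ℕ} {π : Equiv.Perm ℤ} (hπ : IsSignedPerm n π) :
    ∃ J ⊆ Icc 1 n, (Icc 1 n).image (window π) = signedSet n J := by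
  refine ⟨(Icc 1 n).filter fun j : ℕ => -(j : ℤ) ∈ (Icc 1 n).image (window π),
    filter_subset _ _, ?_⟩
  refine eq_of_subset_of_card_le ?_ ?_
  · intro x hx
    obtain ⟨i, hi, hix⟩ := mem_image.mp hx
    rw [window] at hix
    have hi' := mem_Icc.mp hi
    have h0 : π 0 = 0 := by have := hπ.1 0; rw [neg_zero] at this; omega
    have hx0 : x ≠ 0 := by
      rintro rfl
      have := π.injective (hix.trans h0.symm)
      omega
    have hxn : ¬ (n : ℤ) < |x| := by
      intro h
      have h' := hπ.2 x h
      have := π.injective (h'.trans hix.symm)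
      rw [this, Nat.abs_cast] at h
      omega
    have habs : x.natAbs ∈ Icc 1 n := by rw [Int.abs_eq_natAbs] at hxn; rw [mem_Icc]; omega
    rw [mem_signedSet, mem_filter]
    refine ⟨habs, fun h => ⟨habs, ?_⟩, fun h => ?_⟩
    · rwa [show -(x.natAbs : ℤ) = x by omega]
    · by_contra hneg
      obtain ⟨k, hk, hkx⟩ := mem_image.mp h.2
      rw [window, show -(x.natAbs : ℤ) = -x by omega, ← hix, ← hπ.1] at hkx
      have := π.injective hkx
      have := mem_Icc.mp hk
      omega
  · rw [card_signedSet, card_image_of_injective _ (window_injective π), Nat.card_Icc,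
      Nat.add_sub_cancel]

theorem exists_signedPerm_of_image {n : ℕ} {J : Finset ℕ} {w : ℕ → ℤ}
    (hw : Set.InjOn w (Icc 1 n : Finset ℕ)) (him : (Icc 1 n).image w = signedSet n J) :
    ∃ π : Equiv.Perm ℤ, IsSignedPerm n π ∧ ∀ i ∈ Icc 1 n, window π i = w i := by
  have hmem : ∀ i ∈ Icc 1 n, w i ∈ signedSet n J := fun i hi => him ▸ mem_image_of_mem w hi
  have habs : ∀ i ∈ Icc 1 n, (w i).natAbs ∈ Icc 1 n := fun i hi => (mem_signedSet.mp (hmem i hi)).1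
  let f : ℤ → ℤ := fun a => if a.natAbs ∈ Icc 1 n then a.sign * w a.natAbs else a
  have f_pos : ∀ i ∈ Icc 1 n, f i = w i := by
    intro i hi
    have := mem_Icc.mp hi
    simp only [f, Int.natAbs_natCast, if_pos hi]
    rw [Int.sign_eq_one_of_pos (by omega), one_mul]
  have f_neg : ∀ a, f (-a) = - f a := by
    intro a
    simp only [f, Int.natAbs_neg, Int.sign_neg]
    split_ifs <;> ring
  have f_out : ∀ a : ℤ, a.natAbs ∉ Icc 1 n → f a = a := fun a ha => if_neg ha
  have f_abs : ∀ a : ℤ, a.natAbs ∈ Icc 1 n → (f a).natAbs = (w a.natAbs).natAbs := by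
    intro a ha
    have := mem_Icc.mp ha
    simp only [f, if_pos ha]
    rw [Int.natAbs_mul, Int.natAbs_sign_of_ne_zero (by omega), one_mul]
  have f_inj : Function.Injective f := by
    intro a b hab
    by_cases ha : a.natAbs ∈ Icc 1 n <;> by_cases hb : b.natAbs ∈ Icc 1 n
    · have h := congrArg Int.natAbs hab
      rw [f_abs a ha, f_abs b hb] at h
      have h' := hw ha hb (natAbs_injOn_signedSet n J (hmem _ ha) (hmem _ hb) h)
      rcases Int.natAbs_eq_natAbs_iff.mp h' with h | rfl
      · exact h
      · rw [f_neg] at hab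
        have h1 := f_abs b hb
        have h2 := mem_Icc.mp (habs _ hb)
        omega
    · have h := f_abs a ha
      rw [hab, f_out b hb] at h
      exact absurd (h ▸ habs _ ha) hb
    · have h := f_abs b hb
      rw [← hab, f_out a ha] at h
      exact absurd (h ▸ habs _ hb) ha
    · rwa [f_out a ha, f_out b hb] at hab
  have f_surj : Function.Surjective f := by
    intro y
    by_cases hy : y.natAbs ∈ Icc 1 n
    · have hy' := hy
      rw [← image_natAbs_signedSet n J, ← him, image_image, mem_image] at hy'
      obtain ⟨i, hi, h⟩ := hy'
      rcases Int.natAbs_eq_natAbs_iff.mp h with h | h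
      · exact ⟨i, (f_pos i hi).trans h⟩
      · exact ⟨-i, by rw [f_neg, f_pos i hi, h, neg_neg]⟩
    · exact ⟨y, f_out y hy⟩
  refine ⟨Equiv.ofBijective f ⟨f_inj, f_surj⟩, ⟨f_neg, fun a ha => f_out a ?_⟩, f_pos⟩
  rw [Int.abs_eq_natAbs] at ha
  rw [mem_Icc]
  omega

theorem injOn_word_window (n : ℕ) : Set.InjOn (fun π => word (window π) n) (BSet n) := by
  intro π hπ ρ hρ h
  have h := word_eq_word_iff.mp h
  have hpos : ∀ a : ℤ, 0 ≤ a → π a = ρ a := by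
    intro a ha
    rcases Int.eq_ofNat_of_zero_le ha with ⟨k, rfl⟩
    by_cases hk : k ∈ Icc 1 n
    · exact h k hk
    · rw [mem_Icc] at hk
      rcases Nat.eq_zero_or_pos k with rfl | hk0
      · have h1 := hπ.1 0
        have h2 := hρ.1 0
        rw [neg_zero] at h1 h2
        simp only [Nat.cast_zero]
        omega
      · have hlt : (n : ℤ) < |(k : ℤ)| := by rw [Nat.abs_cast]; omega
        rw [hπ.2 _ hlt, hρ.2 _ hlt]
  ext a
  rcases le_total 0 a with ha | ha
  · exact hpos a ha
  · have := hpos (-a) (by omega)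
    rw [hπ.1, hρ.1] at this
    omega

theorem finsum_BSet {R : Type*} [CommRing R] (n : ℕ) (F : List ℤ → R) :
    ∑ᶠ π ∈ BSet n, F (word (window π) n) =
      ∑ J ∈ (Icc 1 n).powerset, ∑ l ∈ words n (signedSet n J), F l := by
  have himage : (fun π => word (window π) n) '' BSet n =
      ((Icc 1 n).powerset.biUnion fun J => words n (signedSet n J) : Finset (List ℤ)) := by
    ext l
    simp only [Set.mem_image, mem_coe, mem_biUnion, mem_powerset]
    constructor
    · rintro ⟨π, hπ, rfl⟩
      obtain ⟨J, hJ, h⟩ := exists_image_window_eq_signedSet hπ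
      exact ⟨J, hJ, h ▸ word_mem_words (window_injective π).injOn⟩
    · rintro ⟨J, -, hl⟩
      obtain ⟨w, hwl, him, hw⟩ := exists_word_of_mem_words (card_signedSet n J) hl
      obtain ⟨π, hπ, h⟩ := exists_signedPerm_of_image hw him
      exact ⟨π, hπ, (word_eq_word_iff.mpr h).trans hwl⟩
  rw [← finsum_mem_image (f := F) (injOn_word_window n), himage, finsum_mem_coe_finset,
    sum_biUnion]
  intro J hJ K hK hne
  rw [Function.onFun, disjoint_left]
  intro l hl hl'
  refine hne ?_
  rw [← image_natAbs_neg_signedSet (mem_powerset.mp hJ),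
    ← image_natAbs_neg_signedSet (mem_powerset.mp hK),
    ← (spec_of_mem_words (card_signedSet n J) hl).2.2,
    ← (spec_of_mem_words (card_signedSet n K) hl').2.2]

theorem majA_eq_listMaj (n : ℕ) (π : Equiv.Perm ℤ) : majA n π = listMaj (word (window π) n) := by
  induction n with
  | zero => rfl
  | succ n ih =>
    cases n with
    | zero => rfl
    | succ n =>
      rw [word, word, listMaj, ← word, ← ih, length_word, majA, majA, DesA, DesA,
        Nat.add_sub_cancel, Nat.add_sub_cancel, ← insert_Icc_right_eq_Icc_add_one (by omega),
        filter_insert]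
      simp only [window, Nat.cast_add, Nat.cast_one]
      split_ifs
      · rw [sum_insert (by simp), add_comm]
      · rfl

theorem countP_word (p : ℤ → Prop) [DecidablePred p] (w : ℕ → ℤ) (n : ℕ) :
    (word w n).countP p = ((Icc 1 n).filter fun i => p (w i)).card := by
  induction n with
  | zero => rfl
  | succ n ih =>
    rw [word, List.countP_cons, ih, ← insert_Icc_right_eq_Icc_add_one (by omega), filter_insert]
    by_cases h : p (w (n + 1))
    · simp [h]
    · simp [h]

theorem invStat_eq_listInv (n : ℕ) (π : Equiv.Perm ℤ) :
    invStat n π = listInv (word (window π) n) := by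
  induction n with
  | zero => rfl
  | succ n ih =>
    rw [word, listInv, ← ih, countP_word, invStat, invStat,
      ← card_image_of_injective (filter _ (Icc 1 n)) (Prod.mk_left_injective (n + 1)),
      ← card_union_of_disjoint]
    · congr 1
      ext ⟨i, j⟩
      simp only [mem_filter, mem_product, mem_Icc, mem_union, mem_image, Prod.mk.injEq, window]
      constructor
      · rintro ⟨⟨hi, hj⟩, hij, h⟩
        by_cases hjn : j = n + 1
        · subst hjn
          exact Or.inr ⟨i, mem_filter.mpr ⟨mem_Icc.mpr (by omega), h⟩, rfl, rfl⟩
        · exact Or.inl ⟨by omega, hij, h⟩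
      · rintro (⟨h1, h2⟩ | ⟨i, hi, rfl, rfl⟩)
        · exact ⟨by omega, h2⟩
        · obtain ⟨h1, h2⟩ := mem_filter.mp hi
          rw [mem_Icc] at h1
          exact ⟨by omega, by omega, h2⟩
    · rw [disjoint_left]
      rintro ⟨i, j⟩ h h'
      simp only [mem_filter, mem_product, mem_Icc, mem_image, Prod.mk.injEq] at h h'
      obtain ⟨k, -, -, rfl⟩ := h'
      omega

theorem sum_NegSet (n : ℕ) (π : Equiv.Perm ℤ) (h : ℕ → ℕ) :
    ∑ i ∈ NegSet n π, h (π i).natAbs =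
      ∑ x ∈ (word (window π) n).toFinset.filter (· < 0), h x.natAbs := by
  rw [toFinset_word, filter_image, sum_image (window_injective π).injOn]
  rfl

theorem one_add_pow_mul_geom {R : Type*} [CommRing R] (q : R) (i : ℕ) :
    (1 + q ^ i) * ∑ k ∈ range i, q ^ k = (1 + q) * ∑ k ∈ range i, (q ^ 2) ^ k := by
  have h1 : (1 + q ^ i) * ∑ k ∈ range i, q ^ k = ∑ k ∈ range (i + i), q ^ k := by
    rw [sum_range_add, add_mul, one_mul, mul_sum]
    simp only [pow_add]
  rw [h1]
  clear h1
  induction i with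
  | zero => simp
  | succ i ih =>
    rw [show i + 1 + (i + 1) = i + i + 1 + 1 by ring, sum_range_succ, sum_range_succ, ih,
      sum_range_succ]
    ring

theorem finsum_BSet_pow {R : Type*} [CommRing R] (q r : R) (n : ℕ) (stat : List ℤ → ℕ)
    (h : ℕ → ℕ) (hstat : ∀ S : Finset ℤ, S.card = n → ∑ l ∈ words n S, r ^ stat l = qFactorial r n) :
    ∑ᶠ π ∈ BSet n, r ^ stat (word (window π) n) * q ^ ∑ i ∈ NegSet n π, h (π i).natAbs =
      ∏ i ∈ range n, (1 + q ^ h (i + 1)) * ∑ k ∈ range (i + 1), r ^ k := by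
  simp only [sum_NegSet]
  rw [finsum_BSet n fun l => r ^ stat l * q ^ ∑ x ∈ l.toFinset.filter (· < 0), h x.natAbs]
  have key : ∀ J ∈ (Icc 1 n).powerset, ∑ l ∈ words n (signedSet n J),
      r ^ stat l * q ^ ∑ x ∈ l.toFinset.filter (· < 0), h x.natAbs =
        qFactorial r n * ∏ j ∈ J, q ^ h j := by
    intro J hJ
    rw [← hstat _ (card_signedSet n J), sum_mul]
    refine sum_congr rfl fun l hl => ?_
    rw [(spec_of_mem_words (card_signedSet n J) hl).2.2, sum_neg_signedSet (mem_powerset.mp hJ),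
      prod_pow_eq_pow_sum]
  rw [sum_congr rfl key, ← mul_sum, ← prod_one_add, prod_mul_distrib, mul_comm, qFactorial]
  congr 1
  rw [range_eq_Ico, prod_Ico_add' (fun i => 1 + q ^ h i) 0 n 1, zero_add,
    Ico_add_one_right_eq_Icc]

end SignedWord

open SignedWord in
theorem stmt_19 (n : ℕ) (hn : 1 ≤ n) :
    (∑ᶠ π ∈ BSet n, (Polynomial.X : Polynomial ℤ) ^ lenB n π) =
      (∑ᶠ π ∈ BSet n, (Polynomial.X : Polynomial ℤ) ^ nmaj n π) ∧
    (∑ᶠ π ∈ BSet n, (Polynomial.X : Polynomial ℤ) ^ nmaj n π) =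
      ∑ᶠ π ∈ BSet n, (Polynomial.X : Polynomial ℤ) ^ fmaj n π := by
  have hlen := finsum_BSet_pow (Polynomial.X : Polynomial ℤ) Polynomial.X n listInv id
    (sum_words_listInv _ n)
  have hnmaj := finsum_BSet_pow (Polynomial.X : Polynomial ℤ) Polynomial.X n listMaj id
    (sum_words_listMaj _ n)
  have hfmaj := finsum_BSet_pow (Polynomial.X : Polynomial ℤ) (Polynomial.X ^ 2) n listMaj
    (fun _ => 1) (sum_words_listMaj _ n)
  simp only [← invStat_eq_listInv, ← majA_eq_listMaj, ← pow_mul, ← pow_add, id, sum_const,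
    smul_eq_mul, mul_one, pow_one] at hlen hnmaj hfmaj
  refine ⟨hlen.trans hnmaj.symm, hnmaj.trans (Eq.trans ?_ hfmaj.symm)⟩
  refine prod_congr rfl fun i _ => ?_
  simpa only [← pow_mul] using one_add_pow_mul_geom (Polynomial.X : Polynomial ℤ) (i + 1)
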